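/- arXiv:0708.1951 — 2 statements merged into one kernel-verified Lean document; each statement's English description precedes it below -/
import Mathlib

section
/- Let R be a commutative ring, M an R-module, and f : M × M → R a bilinear form that is antisymmetric (f(x,y) = −f(y,x) for all x,y) and alternating (f(x,x) = 0 for all x). Then the operation x ▷ y = x + f(x,y)·y on M is idempotent (a ▷ a = a for all a) and right self-distributive: (a ▷ b) ▷ c = (a ▷ c) ▷ (b ▷ c) for all a, b, c ∈ M. Hence (M, ▷) is a quandle (the symplectic quandle, or quandle of transvections). -/
/-- For an antisymmetric alternating bilinear form `f` on an `R`-module `M`,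
the operation `x ▷ y = x + f x y • y` is idempotent and right self-distributive,
so it gives `M` the structure of a quandle (the symplectic quandle). -/
theorem symplectic_quandle_idempotent_and_distributive
    {R M : Type*} [CommRing R] [AddCommGroup M] [Module R M]
    (f : M →ₗ[R] M →ₗ[R] R)
    (hanti : ∀ x y : M, f x y = - f y x) (halt : ∀ x : M, f x x = 0) :
    (∀ a : M, a + f a a • a = a) ∧
    (∀ a b c : M,
      (a + f a b • b) + f (a + f a b • b) c • c =
      (a + f a c • c) + f (a + f a c • c) (b + f b c • c) • (b + f b c • c)) := by
  refine ⟨fun a => by simp [halt], fun a b c => ?_⟩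
  have h : f (a + f a c • c) (b + f b c • c) = f a b := by
    simp only [map_add, map_smul, LinearMap.add_apply, LinearMap.smul_apply, smul_eq_mul, halt,
      hanti c b]
    ring
  rw [h]
  simp only [map_add, map_smul, LinearMap.add_apply, LinearMap.smul_apply, smul_eq_mul]
  module
end

section
/- Let R be a commutative ring, M an R-module, and f : M × M → R a bilinear form that is antisymmetric (f(x,y) = −f(y,x)) and alternating (f(x,x) = 0). Define S : M × M → M × M by S(x,y) = (y, x + f(x,y)·y). Then S satisfies the set-theoretic Yang–Baxter equation: (S × Id) ∘ (Id × S) ∘ (S × Id) = (Id × S) ∘ (S × Id) ∘ (Id × S) as maps M × M × M → M × M × M. -/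
/-- The symplectic quandle switch `S (x, y) = (y, x + f x y • y)` associated to an
antisymmetric alternating bilinear form satisfies the set-theoretic Yang-Baxter
equation `(S × Id) ∘ (Id × S) ∘ (S × Id) = (Id × S) ∘ (S × Id) ∘ (Id × S)`. -/
theorem symplectic_switch_yang_baxter
    {R M : Type*} [CommRing R] [AddCommGroup M] [Module R M]
    (f : M →ₗ[R] M →ₗ[R] R)
    (hanti : ∀ x y : M, f x y = - f y x) (halt : ∀ x : M, f x x = 0)
    (S : M × M → M × M) (hS : ∀ x y : M, S (x, y) = (y, x + f x y • y))
    (SId : M × M × M → M × M × M)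
    (hSId : ∀ p : M × M × M, SId p = ((S (p.1, p.2.1)).1, (S (p.1, p.2.1)).2, p.2.2))
    (IdS : M × M × M → M × M × M)
    (hIdS : ∀ p : M × M × M, IdS p = (p.1, S p.2)) :
    SId ∘ IdS ∘ SId = IdS ∘ SId ∘ IdS := by
  funext p
  obtain ⟨x, y, z⟩ := p
  have key : f (x + f x z • z) (y + f y z • z) = f x y := by
    simp only [map_add, map_smul, LinearMap.add_apply, LinearMap.smul_apply, smul_eq_mul, halt,
      hanti z y]
    ring
  simp only [Function.comp_apply, hSId, hIdS, hS, key, Prod.mk.injEq, true_and]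
  simp only [map_add, map_smul, LinearMap.add_apply, LinearMap.smul_apply, smul_eq_mul]
  module
end
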